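/- For every K > 0 there exists a constant C > 0 such that the following holds: for all level-2 α-Hölder rough paths 𝐗 and 𝐗̃ over V with ‖𝐗‖_α ≤ K and ‖𝐗̃‖_α ≤ K, every F ∈ C_b^3(W, L(U,W)) with ‖F‖_{C_b^3} ≤ K, every 𝐗-controlled rough path 𝐙 = (Z,Z') and every 𝐗̃-controlled rough path 𝐙̃ = (Z̃,Z̃') with values in U, and every 𝐗-controlled rough path 𝐘 = (Y,Y') and every 𝐗̃-controlled rough path 𝐘̃ = (Ỹ,Ỹ') with values in W, all satisfying ‖Y'_0‖, ‖Ỹ'_0‖, ‖Z'_0‖, ‖Z̃'_0‖ ≤ K and ‖𝐘‖_{𝐗;α}, ‖𝐘̃‖_{𝐗̃;α}, ‖𝐙‖_{𝐗;α}, ‖𝐙̃‖_{𝐗̃;α} ≤ K: d_{𝐗,𝐗̃;α}(𝐉, 𝐉̃) ≤ C ( T^α d_{𝐗,𝐗̃;α}(𝐘,𝐘̃) + ‖Y_0 − Ỹ_0‖ + ‖Y'_0 − Ỹ'_0‖ + d_{𝐗,𝐗̃;α}(𝐙,𝐙̃) + ‖Z_0 − Z̃_0‖ + ‖Z'_0 −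 Z̃'_0‖ + ‖𝐗 − 𝐗̃‖_α ), where 𝐉 := (t ↦ Y_0 + ∫_0^t F(Y_r) dZ_r, t ↦ F(Y_t) ∘ Z'_t) is formed with the rough integral over 𝐗 and 𝐉̃ := (t ↦ Ỹ_0 + ∫_0^t F(Ỹ_r) dZ̃_r, t ↦ F(Ỹ_t) ∘ Z̃'_t) with the rough integral over 𝐗̃. -/

import Mathlib

/-!  Common definitions: level-2 rough paths, controlled rough paths,
compensated Riemann sums and rough integrals of a controlled rough path
against another controlled rough path. -/

open scoped BigOperators

noncomputable section

/-- `HBound T β A` : the two-parameter map `A` satisfies a `β`-Hölder bound on the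
simplex `{0 ≤ s < t ≤ T}`. -/
def HBound {E : Type*} [NormedAddCommGroup E] (T β : ℝ) (A : ℝ → ℝ → E) : Prop :=
  ∃ C : ℝ, ∀ s t : ℝ, 0 ≤ s → s < t → t ≤ T → ‖A s t‖ ≤ C * (t - s) ^ β

/-- The Hölder seminorm `‖A‖_β = sup_{0 ≤ s < t ≤ T} ‖A_{s,t}‖ / (t-s)^β`, realised as the
least admissible Hölder constant. -/
def hnorm {E : Type*} [NormedAddCommGroup E] (T β : ℝ) (A : ℝ → ℝ → E) : ℝ :=
  sInf {C : ℝ | 0 ≤ C ∧ ∀ s t : ℝ, 0 ≤ s → s < t → t ≤ T → ‖A s t‖ ≤ C * (t - s) ^ β}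

/-- An abstract model of the projective tensor product `V ⊗̂ V`, bundling the canonical
bounded bilinear map `tmul : V × V → V ⊗̂ V` and the pairing `⋆` sending
`A ∈ L(V, L(W,U))` and `B ∈ L(V,W)` to the induced operator `A ⋆ B ∈ L(V ⊗̂ V, U)`,
characterised by `(A ⋆ B)(v₁ ⊗ v₂) = (A v₁)(B v₂)` and `‖A ⋆ B‖ ≤ ‖A‖ ‖B‖`. -/
structure TensorOps (V V2 W U : Type*)
    [NormedAddCommGroup V] [NormedSpace ℝ V] [NormedAddCommGroup V2] [NormedSpace ℝ V2]
    [NormedAddCommGroup W] [NormedSpace ℝ W] [NormedAddCommGroup U] [NormedSpace ℝ U] where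
  tmul : V →L[ℝ] V →L[ℝ] V2
  tmul_le : ∀ a b : V, ‖tmul a b‖ ≤ ‖a‖ * ‖b‖
  spair : (V →L[ℝ] (W →L[ℝ] U)) →L[ℝ] ((V →L[ℝ] W) →L[ℝ] (V2 →L[ℝ] U))
  spair_tmul : ∀ (A : V →L[ℝ] (W →L[ℝ] U)) (B : V →L[ℝ] W) (a b : V),
    spair A B (tmul a b) = (A a) (B b)
  spair_le : ∀ (A : V →L[ℝ] (W →L[ℝ] U)) (B : V →L[ℝ] W), ‖spair A B‖ ≤ ‖A‖ * ‖B‖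

section Defs

variable {V V2 E : Type*}
  [NormedAddCommGroup V] [NormedSpace ℝ V] [NormedAddCommGroup V2] [NormedSpace ℝ V2]
  [NormedAddCommGroup E] [NormedSpace ℝ E]

/-- `(X, XX)` is a level-2 `α`-Hölder rough path on `[0,T]`:
Chen's relation plus the analytic estimates. -/
structure IsRoughPath (T α : ℝ) (tmul : V →L[ℝ] V →L[ℝ] V2)
    (X : ℝ → V) (XX : ℝ → ℝ → V2) : Prop where
  chen : ∀ s u t : ℝ, 0 ≤ s → s ≤ u → u ≤ t → t ≤ T →
    XX s t = XX s u + XX u t + tmul (X u - X s) (X t - X u)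
  x_hold : HBound T α fun s t => X t - X s
  xx_hold : HBound T (2 * α) XX

/-- `‖𝐗‖_α := ‖X‖_α + ‖𝕏‖_{2α}`. -/
def rpNorm (T α : ℝ) (X : ℝ → V) (XX : ℝ → ℝ → V2) : ℝ :=
  hnorm T α (fun s t => X t - X s) + hnorm T (2 * α) XX

/-- `‖𝐗 − 𝐗̃‖_α := ‖X − X̃‖_α + ‖𝕏 − 𝕏̃‖_{2α}`. -/
def rpDist (T α : ℝ) (X Xt : ℝ → V) (XX XXt : ℝ → ℝ → V2) : ℝ :=
  hnorm T α (fun s t => (X t - X s) - (Xt t - Xt s)) +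
    hnorm T (2 * α) fun s t => XX s t - XXt s t

/-- The remainder `R^{𝐘}_{s,t} := Y_{s,t} − Y'_s(X_{s,t})` of a controlled rough path. -/
def Rem (X : ℝ → V) (Y : ℝ → E) (Y' : ℝ → V →L[ℝ] E) (s t : ℝ) : E :=
  Y t - Y s - Y' s (X t - X s)

/-- `(Y, Y')` is an `𝐗`-controlled rough path on `[0,T]` with values in `E`. -/
structure IsCRP (T α : ℝ) (X : ℝ → V) (Y : ℝ → E) (Y' : ℝ → V →L[ℝ] E) : Prop where
  deriv_hold : HBound T α fun s t => Y' t - Y' s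
  rem_hold : HBound T (2 * α) (Rem X Y Y')

/-- `‖𝐘‖_{𝐗;α} := ‖R^{𝐘}‖_{2α} + ‖Y'‖_α`. -/
def crpNorm (T α : ℝ) (X : ℝ → V) (Y : ℝ → E) (Y' : ℝ → V →L[ℝ] E) : ℝ :=
  hnorm T (2 * α) (Rem X Y Y') + hnorm T α fun s t => Y' t - Y' s

/-- `d_{𝐗,𝐗̃;α}(𝐘,𝐘̃) := ‖R^{𝐘} − R^{𝐘̃}‖_{2α} + ‖Y' − Ỹ'‖_α`. -/
def crpDist (T α : ℝ) (X Xt : ℝ → V) (Y : ℝ → E) (Y' : ℝ → V →L[ℝ] E)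
    (Yt : ℝ → E) (Yt' : ℝ → V →L[ℝ] E) : ℝ :=
  hnorm T (2 * α) (fun s t => Rem X Y Y' s t - Rem Xt Yt Yt' s t) +
    hnorm T α fun s t => (Y' t - Y' s) - (Yt' t - Yt' s)

/-- `p` is a finite partition `s = p 0 < p 1 < ⋯ < p n = t` of `[s,t]`. -/
def IsPartition (s t : ℝ) (n : ℕ) (p : ℕ → ℝ) : Prop :=
  p 0 = s ∧ p n = t ∧ ∀ i < n, p i < p (i + 1)

end Defs

section Sums

variable {V V2 W U : Type*}
  [NormedAddCommGroup V] [NormedSpace ℝ V] [NormedAddCommGroup V2] [NormedSpace ℝ V2]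
  [NormedAddCommGroup W] [NormedSpace ℝ W] [NormedAddCommGroup U] [NormedSpace ℝ U]

/-- The compensated Riemann sum
`∫_P Y dZ := Σ_i [ Y_{t_i}(Z_{t_i,t_{i+1}}) + (Y'_{t_i} ⋆ Z'_{t_i})(𝕏_{t_i,t_{i+1}}) ]`. -/
def rsum (tops : TensorOps V V2 W U) (XX : ℝ → ℝ → V2)
    (Y : ℝ → W →L[ℝ] U) (Y' : ℝ → V →L[ℝ] (W →L[ℝ] U))
    (Z : ℝ → W) (Z' : ℝ → V →L[ℝ] W) (n : ℕ) (p : ℕ → ℝ) : U :=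
  ∑ i ∈ Finset.range n,
    ((Y (p i)) (Z (p (i + 1)) - Z (p i)) +
      (tops.spair (Y' (p i)) (Z' (p i))) (XX (p i) (p (i + 1))))

/-- `I` is the rough integral `∫_s^t Y dZ`: the limit of the compensated Riemann sums
as the mesh of the partition tends to `0`. -/
def IsRoughIntegral (tops : TensorOps V V2 W U) (XX : ℝ → ℝ → V2)
    (Y : ℝ → W →L[ℝ] U) (Y' : ℝ → V →L[ℝ] (W →L[ℝ] U))
    (Z : ℝ → W) (Z' : ℝ → V →L[ℝ] W) (s t : ℝ) (I : U) : Prop :=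
  ∀ ε : ℝ, 0 < ε → ∃ δ : ℝ, 0 < δ ∧ ∀ (n : ℕ) (p : ℕ → ℝ), IsPartition s t n p →
    (∀ i < n, p (i + 1) - p i < δ) → ‖rsum tops XX Y Y' Z Z' n p - I‖ ≤ ε

end Sums

/-- The constant `C_α := (1 + T^α + T^{2α}) · 2^{3α} · Σ_{n≥1} n^{-3α}`. -/
def Calpha (T α : ℝ) : ℝ :=
  (1 + T ^ α + T ^ (2 * α)) * (2 : ℝ) ^ (3 * α) * ∑' n : ℕ, ((n : ℝ) + 1) ^ (-(3 * α))

/-- `F ∈ C_b^k`: `k` times continuously Fréchet differentiable with all derivatives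
up to order `k` bounded. -/
def IsCb {E₁ E₂ : Type*} [NormedAddCommGroup E₁] [NormedSpace ℝ E₁]
    [NormedAddCommGroup E₂] [NormedSpace ℝ E₂] (k : ℕ) (F : E₁ → E₂) : Prop :=
  ContDiff ℝ (k : ℕ∞) F ∧ ∀ j ≤ k, ∃ C : ℝ, ∀ x, ‖iteratedFDeriv ℝ j F x‖ ≤ C

/-- `‖F‖_{C_b^k} := Σ_{j=0}^k sup_x ‖D^j F(x)‖`. -/
def cbNorm {E₁ E₂ : Type*} [NormedAddCommGroup E₁] [NormedSpace ℝ E₁]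
    [NormedAddCommGroup E₂] [NormedSpace ℝ E₂] (k : ℕ) (F : E₁ → E₂) : ℝ :=
  ∑ j ∈ Finset.range (k + 1), ⨆ x : E₁, ‖iteratedFDeriv ℝ j F x‖

end

section PairBound

variable {E F G : Type*} [NormedAddCommGroup E] [NormedAddCommGroup F] [NormedAddCommGroup G]

/-- Both `x` and `y` have norm at most `c`, and their difference has norm at most `c * δ`. -/
structure PairBound (δ c : ℝ) (x y : E) : Prop where
  left : ‖x‖ ≤ c
  right : ‖y‖ ≤ c
  diff : ‖x - y‖ ≤ c * δ

namespace PairBound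

variable {δ c c₁ c₂ : ℝ} {x y x₁ y₁ x₂ y₂ : E}

theorem nonneg (h : PairBound δ c x y) : 0 ≤ c := (norm_nonneg _).trans h.left

theorem mono (hδ : 0 ≤ δ) (h : PairBound δ c₁ x y) (hc : c₁ ≤ c₂) : PairBound δ c₂ x y :=
  ⟨h.left.trans hc, h.right.trans hc, h.diff.trans (mul_le_mul_of_nonneg_right hc hδ)⟩

theorem add (h₁ : PairBound δ c₁ x₁ y₁) (h₂ : PairBound δ c₂ x₂ y₂) :
    PairBound δ (c₁ + c₂) (x₁ + x₂) (y₁ + y₂) := by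
  refine ⟨norm_add_le_of_le h₁.left h₂.left, norm_add_le_of_le h₁.right h₂.right, ?_⟩
  rw [add_sub_add_comm, add_mul]
  exact norm_add_le_of_le h₁.diff h₂.diff

theorem neg (h : PairBound δ c x y) : PairBound δ c (-x) (-y) := by
  refine ⟨by simpa using h.left, by simpa using h.right, ?_⟩
  rw [neg_sub_neg, norm_sub_rev]
  exact h.diff

theorem congr (h : PairBound δ c x₁ y₁) (hx : x₂ = x₁) (hy : y₂ = y₁) :
    PairBound δ c x₂ y₂ := by
  rwa [hx, hy]

/-- Pair bounds pass to limits. -/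
theorem of_approx (h : ∀ ε > 0, ∃ x' y', ‖x' - x‖ ≤ ε ∧ ‖y' - y‖ ≤ ε ∧ PairBound δ c x' y') :
    PairBound δ c x y := by
  refine ⟨le_of_forall_pos_le_add fun ε hε => ?_, le_of_forall_pos_le_add fun ε hε => ?_,
    le_of_forall_pos_le_add fun ε hε => ?_⟩
  · obtain ⟨x', y', hx, -, h'⟩ := h ε hε
    have := norm_sub_le x' (x' - x)
    rw [sub_sub_cancel] at this
    linarith [h'.left]
  · obtain ⟨x', y', -, hy, h'⟩ := h ε hε
    have := norm_sub_le y' (y' - y)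
    rw [sub_sub_cancel] at this
    linarith [h'.right]
  · obtain ⟨x', y', hx, hy, h'⟩ := h (ε / 2) (half_pos hε)
    have e : x - y = (x' - y') - (x' - x) + (y' - y) := by abel
    rw [e]
    have := norm_add_le_of_le (norm_sub_le_of_le h'.diff hx) hy
    linarith

theorem of_lipschitz {g : E → F} {M δ d : ℝ} (hM : 0 ≤ M) (hδ : 0 ≤ δ) (hd : 0 ≤ d)
    (hb : ∀ x, ‖g x‖ ≤ M) (hl : ∀ x y, ‖g x - g y‖ ≤ M * ‖x - y‖) {x y : E}
    (hxy : ‖x - y‖ ≤ d * δ) : PairBound δ (M * (1 + d)) (g x) (g y) := by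
  have h1 : M ≤ M * (1 + d) := le_mul_of_one_le_right hM (by linarith)
  refine ⟨(hb x).trans h1, (hb y).trans h1, ?_⟩
  calc ‖g x - g y‖ ≤ M * (d * δ) := (hl x y).trans (mul_le_mul_of_nonneg_left hxy hM)
    _ ≤ M * (1 + d) * δ := by nlinarith [mul_nonneg hM hδ]

variable [NormedSpace ℝ E] [NormedSpace ℝ F] [NormedSpace ℝ G]

theorem smul (h : PairBound δ c x y) {θ : ℝ} (h0 : 0 ≤ θ) (h1 : θ ≤ 1) :
    PairBound δ c (θ • x) (θ • y) := by
  have key : ∀ z : E, ‖θ • z‖ ≤ ‖z‖ := fun z => by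
    rw [norm_smul, Real.norm_of_nonneg h0]
    exact mul_le_of_le_one_left (norm_nonneg z) h1
  refine ⟨(key x).trans h.left, (key y).trans h.right, ?_⟩
  rw [← smul_sub]
  exact (key _).trans h.diff

theorem bilin (B : E →L[ℝ] F →L[ℝ] G) (hB : ∀ a b, ‖B a b‖ ≤ ‖a‖ * ‖b‖)
    (h₁ : PairBound δ c₁ x₁ y₁) {a b : F} (h₂ : PairBound δ c₂ a b) :
    PairBound δ (2 * c₁ * c₂) (B x₁ a) (B y₁ b) := by
  have hc₁ := h₁.nonneg
  have hc₂ := h₂.nonneg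
  have h12 : 0 ≤ c₁ * c₂ := mul_nonneg hc₁ hc₂
  have hδ₁ : 0 ≤ c₁ * δ := (norm_nonneg _).trans h₁.diff
  refine ⟨?_, ?_, ?_⟩
  · have := (hB x₁ a).trans (mul_le_mul h₁.left h₂.left (norm_nonneg _) hc₁)
    linarith
  · have := (hB y₁ b).trans (mul_le_mul h₁.right h₂.right (norm_nonneg _) hc₁)
    linarith
  · have e : B x₁ a - B y₁ b = B (x₁ - y₁) a + B y₁ (a - b) := by simp
    rw [e]
    have e₁ := (hB (x₁ - y₁) a).trans (mul_le_mul h₁.diff h₂.left (norm_nonneg _) hδ₁)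
    have e₂ := (hB y₁ (a - b)).trans (mul_le_mul h₁.right h₂.diff (norm_nonneg _) hc₁)
    refine (norm_add_le_of_le e₁ e₂).trans (le_of_eq ?_)
    ring

theorem apply {f g : E →L[ℝ] F} (h₁ : PairBound δ c₁ f g) (h₂ : PairBound δ c₂ x y) :
    PairBound δ (2 * c₁ * c₂) (f x) (g y) :=
  bilin (ContinuousLinearMap.id ℝ (E →L[ℝ] F)) (fun a b => a.le_opNorm b) h₁ h₂

theorem comp {f g : F →L[ℝ] G} {a b : E →L[ℝ] F} (h₁ : PairBound δ c₁ f g)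
    (h₂ : PairBound δ c₂ a b) : PairBound δ (2 * c₁ * c₂) (f.comp a) (g.comp b) :=
  bilin (ContinuousLinearMap.compL ℝ E F G) (fun a b => a.opNorm_comp_le b) h₁ h₂

/-- Mean value inequality for a pair of paths. -/
theorem image_sub {f g f' g' : ℝ → E}
    (hf : ∀ θ, HasDerivAt f (f' θ) θ) (hg : ∀ θ, HasDerivAt g (g' θ) θ)
    (h : ∀ θ, 0 ≤ θ → θ ≤ 1 → PairBound δ c (f' θ) (g' θ)) :
    PairBound δ c (f 1 - f 0) (g 1 - g 0) := by
  refine ⟨?_, ?_, ?_⟩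
  · exact norm_image_sub_le_of_norm_deriv_le_segment_01'
      (fun θ _ => (hf θ).hasDerivWithinAt) fun θ hθ => (h θ hθ.1 hθ.2.le).left
  · exact norm_image_sub_le_of_norm_deriv_le_segment_01'
      (fun θ _ => (hg θ).hasDerivWithinAt) fun θ hθ => (h θ hθ.1 hθ.2.le).right
  · rw [sub_sub_sub_comm]
    exact norm_image_sub_le_of_norm_deriv_le_segment_01' (f := fun θ => f θ - g θ)
      (fun θ _ => ((hf θ).sub (hg θ)).hasDerivWithinAt)
      fun θ hθ => (h θ hθ.1 hθ.2.le).diff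

end PairBound

variable [NormedSpace ℝ E] [NormedSpace ℝ F]

/-- `g` has derivative `g'`, which is bounded by `M` and `M`-Lipschitz. -/
structure SmoothBound (M : ℝ) (g : E → F) (g' : E → E →L[ℝ] F) : Prop where
  hasFDerivAt : ∀ x, HasFDerivAt g (g' x) x
  bound : ∀ x, ‖g' x‖ ≤ M
  lip : ∀ x y, ‖g' x - g' y‖ ≤ M * ‖x - y‖

theorem norm_sub_le_of_hasFDerivAt {g : E → F} {g' : E → E →L[ℝ] F} {M : ℝ}
    (h : ∀ x, HasFDerivAt g (g' x) x) (hb : ∀ x, ‖g' x‖ ≤ M) (x y : E) :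
    ‖g x - g y‖ ≤ M * ‖x - y‖ :=
  convex_univ.norm_image_sub_le_of_norm_hasFDerivWithin_le
    (fun z _ => (h z).hasFDerivWithinAt) (fun z _ => hb z) trivial trivial

theorem norm_line_sub_le {b bt h ht : E} {δ d k θ : ℝ} (hb : ‖b - bt‖ ≤ d * δ)
    (hh : PairBound δ k h ht) (h0 : 0 ≤ θ) (h1 : θ ≤ 1) :
    ‖(b + θ • h) - (bt + θ • ht)‖ ≤ (d + k) * δ := by
  rw [add_sub_add_comm, add_mul]
  exact norm_add_le_of_le hb (hh.smul h0 h1).diff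

theorem hasDerivAt_line {g : E → F} {g' : E → E →L[ℝ] F} (hg : ∀ x, HasFDerivAt g (g' x) x)
    (b h : E) (θ : ℝ) : HasDerivAt (fun θ : ℝ => g (b + θ • h)) (g' (b + θ • h) h) θ := by
  have h1 : HasDerivAt (fun θ : ℝ => b + θ • h) h θ := by
    simpa using ((hasDerivAt_id θ).smul_const h).const_add b
  exact (hg _).comp_hasDerivAt θ h1

theorem SmoothBound.increment {g : E → F} {g' : E → E →L[ℝ] F} {M δ d k : ℝ}
    (hg : SmoothBound M g g') (hM : 0 ≤ M) (hδ : 0 ≤ δ) (hd : 0 ≤ d)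
    {b bt h ht : E} (hb : ‖b - bt‖ ≤ d * δ) (hh : PairBound δ k h ht) :
    PairBound δ (2 * (M * (1 + (d + k))) * k) (g (b + h) - g b) (g (bt + ht) - g bt) := by
  have hk := hh.nonneg
  have := PairBound.image_sub (hasDerivAt_line hg.hasFDerivAt b h)
    (hasDerivAt_line hg.hasFDerivAt bt ht) (δ := δ) (c := 2 * (M * (1 + (d + k))) * k)
    fun θ h0 h1 => (PairBound.of_lipschitz hM hδ (by positivity) hg.bound hg.lip
      (norm_line_sub_le hb hh h0 h1)).apply hh
  simpa using this

theorem SmoothBound.taylor {g : E → F} {g' : E → E →L[ℝ] F} {g'' : E → E →L[ℝ] E →L[ℝ] F}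
    {M δ d k : ℝ} (hg : SmoothBound M g g') (hg' : SmoothBound M g' g'')
    (hM : 0 ≤ M) (hδ : 0 ≤ δ) (hd : 0 ≤ d)
    {b bt h ht : E} (hb : ‖b - bt‖ ≤ d * δ) (hh : PairBound δ k h ht) :
    PairBound δ (2 * (2 * (M * (1 + (d + k))) * k) * k)
      (g (b + h) - g b - g' b h) (g (bt + ht) - g bt - g' bt ht) := by
  have key : ∀ (b h : E) (θ : ℝ), HasDerivAt (fun θ : ℝ => g (b + θ • h) - θ • g' b h)
      ((g' (b + θ • h) - g' b) h) θ := fun b h θ => by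
    have := (hasDerivAt_line hg.hasFDerivAt b h θ).fun_sub
      ((hasDerivAt_id θ).smul_const (g' b h))
    simpa using this
  have := PairBound.image_sub (key b h) (key bt ht) (δ := δ)
    (c := 2 * (2 * (M * (1 + (d + k))) * k) * k)
    fun θ h0 h1 => (hg'.increment hM hδ hd hb (hh.smul h0 h1)).apply hh
  refine this.congr ?_ ?_ <;> simp <;> abel

end PairBound

section Sewing

theorem IsPartition.append_aux {s u t : ℝ} {n m : ℕ} {p q : ℕ → ℝ} (hp : IsPartition s u n p)
    (hq : IsPartition u t m q) :
    (∀ i ≤ n, (if i < n then p i else q (i - n)) = p i) ∧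
      ∀ i, (if n + i < n then p (n + i) else q (n + i - n)) = q i := by
  refine ⟨fun i hi => ?_, fun i => by simp⟩
  rcases hi.lt_or_eq with h | rfl
  · simp [h]
  · simp [hp.2.1, hq.1]

/-- Concatenation of partitions. -/
theorem IsPartition.exists_append (E : Type*) [AddCommMonoid E]
    {s u t η : ℝ} {n m : ℕ} {p q : ℕ → ℝ}
    (hp : IsPartition s u n p) (hq : IsPartition u t m q)
    (hpη : ∀ i < n, p (i + 1) - p i ≤ η) (hqη : ∀ i < m, q (i + 1) - q i ≤ η) :
    ∃ r, IsPartition s t (n + m) r ∧ (∀ i < n + m, r (i + 1) - r i ≤ η) ∧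
      ∀ A : ℝ → ℝ → E, ∑ i ∈ Finset.range (n + m), A (r i) (r (i + 1)) =
        ∑ i ∈ Finset.range n, A (p i) (p (i + 1)) +
          ∑ i ∈ Finset.range m, A (q i) (q (i + 1)) := by
  obtain ⟨h1, h2⟩ := hp.append_aux hq
  set r : ℕ → ℝ := fun i => if i < n then p i else q (i - n) with hr
  have h1 : ∀ i ≤ n, r i = p i := h1
  have h2 : ∀ i, r (n + i) = q i := h2
  have hcase : ∀ i < n + m, (i < n ∧ r i = p i ∧ r (i + 1) = p (i + 1)) ∨
      ∃ j < m, r i = q j ∧ r (i + 1) = q (j + 1) := by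
    intro i hi
    rcases lt_or_ge i n with h | h
    · exact Or.inl ⟨h, h1 i h.le, h1 (i + 1) h⟩
    · obtain ⟨j, rfl⟩ := Nat.exists_eq_add_of_le h
      exact Or.inr ⟨j, by omega, h2 j, h2 (j + 1)⟩
  refine ⟨r, ⟨by rw [h1 0 (Nat.zero_le _), hp.1], by rw [h2, hq.2.1], fun i hi => ?_⟩,
    fun i hi => ?_, fun A => ?_⟩
  · rcases hcase i hi with ⟨h, e, e'⟩ | ⟨j, h, e, e'⟩ <;> rw [e, e']
    exacts [hp.2.2 i h, hq.2.2 j h]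
  · rcases hcase i hi with ⟨h, e, e'⟩ | ⟨j, h, e, e'⟩ <;> rw [e, e']
    exacts [hpη i h, hqη j h]
  · rw [Finset.sum_range_add]
    congr 1
    · refine Finset.sum_congr rfl fun i hi => ?_
      have := Finset.mem_range.1 hi
      rw [h1 i this.le, h1 (i + 1) this]
    · refine Finset.sum_congr rfl fun i _ => ?_
      rw [h2 i, add_assoc, h2 (i + 1)]

variable {E : Type*} [NormedAddCommGroup E]

/-- The geometric constant in the sewing estimate with exponent `γ`. -/
noncomputable def sewingConst (γ : ℝ) : ℝ := (1 - 2 * (1 / 2 : ℝ) ^ γ)⁻¹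

theorem two_mul_half_rpow_lt_one {γ : ℝ} (hγ : 1 < γ) : 2 * (1 / 2 : ℝ) ^ γ < 1 := by
  have : (1 / 2 : ℝ) ^ γ < (1 / 2 : ℝ) ^ (1 : ℝ) :=
    Real.rpow_lt_rpow_of_exponent_gt (by norm_num) (by norm_num) hγ
  rw [Real.rpow_one] at this
  linarith

theorem sewingConst_pos {γ : ℝ} (hγ : 1 < γ) : 0 < sewingConst γ :=
  inv_pos.2 (sub_pos.2 (two_mul_half_rpow_lt_one hγ))

theorem sewingConst_eq {γ : ℝ} (hγ : 1 < γ) :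
    2 * (sewingConst γ * (1 / 2 : ℝ) ^ γ) + 1 = sewingConst γ := by
  have h := sub_pos.2 (two_mul_half_rpow_lt_one hγ)
  have : sewingConst γ * (1 - 2 * (1 / 2 : ℝ) ^ γ) = 1 := inv_mul_cancel₀ h.ne'
  linarith

/-- Dyadic sewing: fine partitions whose sums are uniformly close to the germ. -/
theorem exists_partition_pairBound {T γ δ c : ℝ} (hγ : 1 < γ) (hδ : 0 ≤ δ) (hc : 0 ≤ c)
    {A At : ℝ → ℝ → E}
    (h : ∀ s u t, 0 ≤ s → s < u → u < t → t ≤ T →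
      PairBound δ (c * (t - s) ^ γ) (A s t - A s u - A u t) (At s t - At s u - At u t))
    (k : ℕ) : ∀ s t, 0 ≤ s → s < t → t ≤ T → ∃ n p, IsPartition s t n p ∧
      (∀ i < n, p (i + 1) - p i ≤ (t - s) / 2 ^ k) ∧
      PairBound δ (sewingConst γ * c * (t - s) ^ γ)
        (∑ i ∈ Finset.range n, A (p i) (p (i + 1)) - A s t)
        (∑ i ∈ Finset.range n, At (p i) (p (i + 1)) - At s t) := by
  have hS := sewingConst_pos hγ
  induction k with
  | zero =>
    intro s t hs hst ht
    have h0 : 0 ≤ sewingConst γ * c * (t - s) ^ γ :=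
      mul_nonneg (mul_nonneg hS.le hc) (Real.rpow_nonneg (by linarith) _)
    refine ⟨1, fun i => if i = 0 then s else t, ⟨by simp, by simp, ?_⟩, ?_, ?_⟩
    · intro i hi
      obtain rfl : i = 0 := by omega
      simpa using hst
    · intro i hi
      obtain rfl : i = 0 := by omega
      simp
    · constructor <;> simp [h0, mul_nonneg h0 hδ]
  | succ k ih =>
    intro s t hs hst ht
    set u := (s + t) / 2 with hu
    have hsu : s < u := by linarith
    have hut : u < t := by linarith
    obtain ⟨n, p, hp, hpm, hpb⟩ := ih s u hs hsu (by linarith)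
    obtain ⟨m, q, hq, hqm, hqb⟩ := ih u t (by linarith) hut ht
    have e₁ : u - s = (t - s) * (1 / 2) := by rw [hu]; ring
    have e₂ : t - u = (t - s) * (1 / 2) := by rw [hu]; ring
    have em : (t - s) * (1 / 2) / 2 ^ k = (t - s) / 2 ^ (k + 1) := by rw [pow_succ]; field_simp
    rw [e₁, em] at hpm
    rw [e₂, em] at hqm
    rw [e₁, Real.mul_rpow (by linarith) (by norm_num)] at hpb
    rw [e₂, Real.mul_rpow (by linarith) (by norm_num)] at hqb
    obtain ⟨r, hr, hrm, hA⟩ := hp.exists_append E hq hpm hqm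
    refine ⟨n + m, r, hr, hrm, ?_⟩
    rw [hA A, hA At]
    refine (((hpb.add hqb).add (h s u t hs hsu hut ht).neg).mono hδ (le_of_eq ?_)).congr
      (by abel) (by abel)
    have := sewingConst_eq hγ
    linear_combination c * (t - s) ^ γ * this

end Sewing

theorem rpow_natCast_mul_eq_pow {x : ℝ} (hx : 0 ≤ x) (α : ℝ) (n : ℕ) :
    x ^ (n * α) = (x ^ α) ^ n := by
  rw [mul_comm, Real.rpow_mul hx, Real.rpow_natCast]

section ControlledPair

variable {V V2 E F W U : Type*}
  [NormedAddCommGroup V] [NormedAddCommGroup V2] [NormedAddCommGroup E] [NormedAddCommGroup F]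
  [NormedAddCommGroup W] [NormedAddCommGroup U]

/-- Standing assumptions on the time horizon, the exponent and the constants. -/
structure Scale (T α M δ : ℝ) : Prop where
  nonneg_exp : 0 < α
  one_le : 1 ≤ M
  nonneg : 0 ≤ δ
  rpow_le : T ^ α ≤ M

theorem Scale.sub_rpow_le {T α M δ : ℝ} (h : Scale T α M δ) {s t : ℝ} (hs : 0 ≤ s)
    (hst : s ≤ t) (ht : t ≤ T) : (t - s) ^ α ≤ M :=
  (Real.rpow_le_rpow (by linarith) (by linarith) h.nonneg_exp.le).trans h.rpow_le

theorem Scale.mono {T α M N δ : ℝ} (h : Scale T α M δ) (hMN : M ≤ N) : Scale T α N δ :=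
  ⟨h.nonneg_exp, h.one_le.trans hMN, h.nonneg, h.rpow_le.trans hMN⟩

/-- Two rough paths bounded by `M` at distance at most `M * δ`. -/
structure RoughPair (T α M δ : ℝ) (X Xt : ℝ → V) (XX XXt : ℝ → ℝ → V2) : Prop where
  path : ∀ s t, 0 ≤ s → s < t → t ≤ T →
    PairBound δ (M * (t - s) ^ α) (X t - X s) (Xt t - Xt s)
  area : ∀ s t, 0 ≤ s → s < t → t ≤ T →
    PairBound δ (M * ((t - s) ^ α) ^ 2) (XX s t) (XXt s t)

theorem RoughPair.mono {T α M N δ : ℝ} {X Xt : ℝ → V} {XX XXt : ℝ → ℝ → V2}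
    (h : RoughPair T α M δ X Xt XX XXt) (hδ : 0 ≤ δ) (hMN : M ≤ N) :
    RoughPair T α N δ X Xt XX XXt where
  path s t hs hst ht := (h.path s t hs hst ht).mono hδ
    (mul_le_mul_of_nonneg_right hMN (Real.rpow_nonneg (by linarith) _))
  area s t hs hst ht := (h.area s t hs hst ht).mono hδ
    (mul_le_mul_of_nonneg_right hMN (by positivity))

variable [NormedSpace ℝ V] [NormedSpace ℝ E]

/-- Two controlled paths bounded by `M` at distance at most `M * δ`. -/
structure ControlledPair (T α M δ : ℝ) (X Xt : ℝ → V) (Y Yt : ℝ → E)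
    (Y' Yt' : ℝ → V →L[ℝ] E) : Prop where
  zero : ‖Y 0 - Yt 0‖ ≤ M * δ
  deriv_zero : PairBound δ M (Y' 0) (Yt' 0)
  deriv : ∀ s t, 0 ≤ s → s < t → t ≤ T →
    PairBound δ (M * (t - s) ^ α) (Y' t - Y' s) (Yt' t - Yt' s)
  rem : ∀ s t, 0 ≤ s → s < t → t ≤ T →
    PairBound δ (M * ((t - s) ^ α) ^ 2) (Rem X Y Y' s t) (Rem Xt Yt Yt' s t)

namespace ControlledPair

variable {T α M δ : ℝ} {X Xt : ℝ → V} {XX XXt : ℝ → ℝ → V2} {Y Yt : ℝ → E}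
  {Y' Yt' : ℝ → V →L[ℝ] E}

theorem mono {N : ℝ} (h : ControlledPair T α M δ X Xt Y Yt Y' Yt') (hδ : 0 ≤ δ) (hMN : M ≤ N) :
    ControlledPair T α N δ X Xt Y Yt Y' Yt' where
  zero := h.zero.trans (mul_le_mul_of_nonneg_right hMN hδ)
  deriv_zero := h.deriv_zero.mono hδ hMN
  deriv s t hs hst ht := (h.deriv s t hs hst ht).mono hδ
    (mul_le_mul_of_nonneg_right hMN (Real.rpow_nonneg (by linarith) _))
  rem s t hs hst ht := (h.rem s t hs hst ht).mono hδ
    (mul_le_mul_of_nonneg_right hMN (by positivity))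

theorem deriv_at (hS : Scale T α M δ) (h : ControlledPair T α M δ X Xt Y Yt Y' Yt')
    {s : ℝ} (hs : 0 ≤ s) (hsT : s ≤ T) : PairBound δ (2 * M ^ 2) (Y' s) (Yt' s) := by
  have hM := hS.one_le
  rcases hs.eq_or_lt with rfl | hs0
  · exact h.deriv_zero.mono hS.nonneg (by nlinarith)
  · refine ((h.deriv_zero.add (h.deriv 0 s le_rfl hs0 hsT)).mono hS.nonneg ?_).congr
      (by abel) (by abel)
    have := mul_le_mul_of_nonneg_left (hS.sub_rpow_le le_rfl hs hsT) (by linarith : 0 ≤ M)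
    nlinarith

theorem increment (hS : Scale T α M δ) (hX : RoughPair T α M δ X Xt XX XXt)
    (h : ControlledPair T α M δ X Xt Y Yt Y' Yt') {s t : ℝ} (hs : 0 ≤ s) (hst : s < t)
    (ht : t ≤ T) : PairBound δ (5 * M ^ 3 * (t - s) ^ α) (Y t - Y s) (Yt t - Yt s) := by
  have hM := hS.one_le
  refine (((h.rem s t hs hst ht).add
    ((h.deriv_at hS hs (hst.le.trans ht)).apply (hX.path s t hs hst ht))).mono hS.nonneg
    ?_).congr (by simp [Rem]) (by simp [Rem])
  have hr := hS.sub_rpow_le hs hst.le ht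
  have hr0 : 0 ≤ (t - s) ^ α := Real.rpow_nonneg (by linarith) _
  calc M * ((t - s) ^ α) ^ 2 + 2 * (2 * M ^ 2) * (M * (t - s) ^ α)
      = M * (t - s) ^ α * (t - s) ^ α + 4 * M ^ 3 * (t - s) ^ α := by ring
    _ ≤ M * M * (t - s) ^ α + 4 * M ^ 3 * (t - s) ^ α := by gcongr
    _ = M ^ 2 * (t - s) ^ α + 4 * M ^ 3 * (t - s) ^ α := by ring
    _ ≤ M ^ 3 * (t - s) ^ α + 4 * M ^ 3 * (t - s) ^ α := by gcongr; norm_num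
    _ = _ := by ring

theorem dist_at (hS : Scale T α M δ) (hX : RoughPair T α M δ X Xt XX XXt)
    (h : ControlledPair T α M δ X Xt Y Yt Y' Yt') {s : ℝ} (hs : 0 ≤ s) (hsT : s ≤ T) :
    ‖Y s - Yt s‖ ≤ 6 * M ^ 4 * δ := by
  have hM := hS.one_le
  have hδ := hS.nonneg
  have h14 : M ≤ M ^ 4 := le_self_pow₀ hM (by norm_num)
  rcases hs.eq_or_lt with rfl | hs0
  · exact h.zero.trans (mul_le_mul_of_nonneg_right (by linarith) hδ)
  · have e : Y s - Yt s = (Y 0 - Yt 0) + ((Y s - Y 0) - (Yt s - Yt 0)) := by abel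
    rw [e]
    refine (norm_add_le_of_le h.zero (h.increment hS hX le_rfl hs0 hsT).diff).trans ?_
    have hr := hS.sub_rpow_le le_rfl hs hsT
    calc M * δ + 5 * M ^ 3 * (s - 0) ^ α * δ ≤ M ^ 4 * δ + 5 * M ^ 3 * M * δ := by gcongr
      _ = _ := by ring

theorem value_at (hS : Scale T α M δ) (hX : RoughPair T α M δ X Xt XX XXt)
    (h : ControlledPair T α M δ X Xt Y Yt Y' Yt') (h0 : PairBound δ M (Y 0) (Yt 0))
    {s : ℝ} (hs : 0 ≤ s) (hsT : s ≤ T) : PairBound δ (6 * M ^ 4) (Y s) (Yt s) := by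
  have hM := hS.one_le
  have h14 : M ≤ M ^ 4 := le_self_pow₀ hM (by norm_num)
  rcases hs.eq_or_lt with rfl | hs0
  · exact h0.mono hS.nonneg (by linarith)
  · refine ((h0.add (h.increment hS hX le_rfl hs0 hsT)).mono hS.nonneg ?_).congr
      (by abel) (by abel)
    have hr := hS.sub_rpow_le le_rfl hs hsT
    calc M + 5 * M ^ 3 * (s - 0) ^ α ≤ M ^ 4 + 5 * M ^ 3 * M := by gcongr
      _ = _ := by ring

theorem comp_value_at (hS : Scale T α M δ) (hX : RoughPair T α M δ X Xt XX XXt)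
    (h : ControlledPair T α M δ X Xt Y Yt Y' Yt') {g : E → F} (hb : ∀ x, ‖g x‖ ≤ M)
    (hl : ∀ x y, ‖g x - g y‖ ≤ M * ‖x - y‖) {s : ℝ} (hs : 0 ≤ s) (hsT : s ≤ T) :
    PairBound δ (7 * M ^ 5) (g (Y s)) (g (Yt s)) := by
  have hM := hS.one_le
  refine (PairBound.of_lipschitz (by linarith) hS.nonneg (by positivity) hb hl
    (h.dist_at hS hX hs hsT)).mono hS.nonneg ?_
  have : M ≤ M ^ 5 := le_self_pow₀ hM (by norm_num)
  linarith

section Composition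

variable [NormedSpace ℝ F] {g : E → F} {g' : E → E →L[ℝ] F} {g'' : E → E →L[ℝ] E →L[ℝ] F}

theorem comp_increment (hS : Scale T α M δ) (hX : RoughPair T α M δ X Xt XX XXt)
    (h : ControlledPair T α M δ X Xt Y Yt Y' Yt') (hg : SmoothBound M g g')
    {s t : ℝ} (hs : 0 ≤ s) (hst : s < t) (ht : t ≤ T) :
    PairBound δ (120 * M ^ 8 * (t - s) ^ α) (g (Y t) - g (Y s)) (g (Yt t) - g (Yt s)) := by
  have hM := hS.one_le
  refine ((hg.increment (by linarith) hS.nonneg (by positivity)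
    (h.dist_at hS hX hs (hst.le.trans ht)) (h.increment hS hX hs hst ht)).mono hS.nonneg
    ?_).congr (by simp) (by simp)
  have hr := hS.sub_rpow_le hs hst.le ht
  have hr0 : 0 ≤ (t - s) ^ α := Real.rpow_nonneg (by linarith) _
  have h1 : 1 ≤ M ^ 4 := one_le_pow₀ hM
  calc 2 * (M * (1 + (6 * M ^ 4 + 5 * M ^ 3 * (t - s) ^ α))) * (5 * M ^ 3 * (t - s) ^ α)
      ≤ 2 * (M * (M ^ 4 + (6 * M ^ 4 + 5 * M ^ 3 * M))) * (5 * M ^ 3 * (t - s) ^ α) := by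
        gcongr
    _ = _ := by ring

theorem comp_taylor (hS : Scale T α M δ) (hX : RoughPair T α M δ X Xt XX XXt)
    (h : ControlledPair T α M δ X Xt Y Yt Y' Yt') (hg : SmoothBound M g g')
    (hg' : SmoothBound M g' g'') {s t : ℝ} (hs : 0 ≤ s) (hst : s < t) (ht : t ≤ T) :
    PairBound δ (1200 * M ^ 11 * ((t - s) ^ α) ^ 2) (g (Y t) - g (Y s) - g' (Y s) (Y t - Y s))
      (g (Yt t) - g (Yt s) - g' (Yt s) (Yt t - Yt s)) := by
  have hM := hS.one_le
  refine ((hg.taylor hg' (by linarith) hS.nonneg (by positivity)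
    (h.dist_at hS hX hs (hst.le.trans ht)) (h.increment hS hX hs hst ht)).mono hS.nonneg
    ?_).congr (by simp) (by simp)
  have hr := hS.sub_rpow_le hs hst.le ht
  have hr0 : 0 ≤ (t - s) ^ α := Real.rpow_nonneg (by linarith) _
  have h1 : 1 ≤ M ^ 4 := one_le_pow₀ hM
  calc 2 * (2 * (M * (1 + (6 * M ^ 4 + 5 * M ^ 3 * (t - s) ^ α))) * (5 * M ^ 3 * (t - s) ^ α)) *
        (5 * M ^ 3 * (t - s) ^ α)
      ≤ 2 * (2 * (M * (M ^ 4 + (6 * M ^ 4 + 5 * M ^ 3 * M))) * (5 * M ^ 3 * (t - s) ^ α)) *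
        (5 * M ^ 3 * (t - s) ^ α) := by gcongr
    _ = _ := by ring

/-- Composition with a smooth function preserves pairs of controlled paths. -/
theorem comp (hS : Scale T α M δ) (hT : 0 ≤ T) (hX : RoughPair T α M δ X Xt XX XXt)
    (h : ControlledPair T α M δ X Xt Y Yt Y' Yt') (hg : SmoothBound M g g')
    (hg' : SmoothBound M g' g'') :
    ControlledPair T α (1214 * M ^ 11) δ X Xt (fun t => g (Y t)) (fun t => g (Yt t))
      (fun t => (g' (Y t)).comp (Y' t)) (fun t => (g' (Yt t)).comp (Yt' t)) := by
  have hM := hS.one_le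
  have hδ := hS.nonneg
  have hv : ∀ {s : ℝ}, 0 ≤ s → s ≤ T → PairBound δ (7 * M ^ 5) (g' (Y s)) (g' (Yt s)) :=
    fun hs hsT => h.comp_value_at hS hX hg.bound hg.lip hs hsT
  constructor
  · calc ‖g (Y 0) - g (Yt 0)‖ ≤ M * ‖Y 0 - Yt 0‖ :=
          norm_sub_le_of_hasFDerivAt hg.hasFDerivAt hg.bound _ _
      _ ≤ M * (M * δ) := mul_le_mul_of_nonneg_left h.zero (by linarith)
      _ = 1 * M ^ 2 * δ := by ring
      _ ≤ 1214 * M ^ 11 * δ := by gcongr <;> norm_num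
  · refine ((hv le_rfl hT).comp h.deriv_zero).mono hδ ?_
    calc 2 * (7 * M ^ 5) * M = 14 * M ^ 6 := by ring
      _ ≤ 1214 * M ^ 11 := by gcongr <;> norm_num
  · intro s t hs hst ht
    have hr0 : 0 ≤ (t - s) ^ α := Real.rpow_nonneg (by linarith) _
    have h₁ := (h.comp_increment hS hX hg' hs hst ht).comp
      (h.deriv_at hS (hs.trans hst.le) ht)
    have h₂ := (hv hs (hst.le.trans ht)).comp (h.deriv s t hs hst ht)
    refine ((h₁.add h₂).mono hδ ?_).congr ?_ ?_
    · calc 2 * (120 * M ^ 8 * (t - s) ^ α) * (2 * M ^ 2) + 2 * (7 * M ^ 5) * (M * (t - s) ^ α)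
          = (480 * M ^ 10 + 14 * M ^ 6) * (t - s) ^ α := by ring
        _ ≤ (480 * M ^ 11 + 14 * M ^ 11) * (t - s) ^ α := by gcongr <;> norm_num
        _ ≤ 1214 * M ^ 11 * (t - s) ^ α := by
          gcongr
          linarith [pow_nonneg (zero_le_one.trans hM) 11]
    all_goals
      ext v
      simp
  · intro s t hs hst ht
    have h₁ := h.comp_taylor hS hX hg hg' hs hst ht
    have h₂ := (hv hs (hst.le.trans ht)).apply (h.rem s t hs hst ht)
    refine ((h₁.add h₂).mono hδ ?_).congr ?_ ?_
    · calc 1200 * M ^ 11 * ((t - s) ^ α) ^ 2 + 2 * (7 * M ^ 5) * (M * ((t - s) ^ α) ^ 2)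
          = (1200 * M ^ 11 + 14 * M ^ 6) * ((t - s) ^ α) ^ 2 := by ring
        _ ≤ (1200 * M ^ 11 + 14 * M ^ 11) * ((t - s) ^ α) ^ 2 := by gcongr; norm_num
        _ = _ := by ring
    all_goals
      simp [Rem]

end Composition

end ControlledPair

section Integral

variable [NormedSpace ℝ W] [NormedSpace ℝ U]

variable {T α N δ : ℝ} {X Xt : ℝ → V} {XX XXt : ℝ → ℝ → V2}
  {Y Yt : ℝ → W →L[ℝ] U} {Y' Yt' : ℝ → V →L[ℝ] (W →L[ℝ] U)}
  {Z Zt : ℝ → W} {Z' Zt' : ℝ → V →L[ℝ] W}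

theorem pairBound_comp_increment (hS : Scale T α N δ) (hX : RoughPair T α N δ X Xt XX XXt)
    (hY : ControlledPair T α N δ X Xt Y Yt Y' Yt') (hY0 : PairBound δ N (Y 0) (Yt 0))
    (hZ : ControlledPair T α N δ X Xt Z Zt Z' Zt')
    {s t : ℝ} (hs : 0 ≤ s) (hst : s < t) (ht : t ≤ T) :
    PairBound δ (32 * N ^ 6 * (t - s) ^ α)
      ((Y t).comp (Z' t) - (Y s).comp (Z' s)) ((Yt t).comp (Zt' t) - (Yt s).comp (Zt' s)) := by
  have hN := hS.one_le
  have hr0 : 0 ≤ (t - s) ^ α := Real.rpow_nonneg (by linarith) _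
  have h₁ := (hY.increment hS hX hs hst ht).comp (hZ.deriv_at hS (hs.trans hst.le) ht)
  have h₂ := (hY.value_at hS hX hY0 hs (hst.le.trans ht)).comp (hZ.deriv s t hs hst ht)
  refine ((h₁.add h₂).mono hS.nonneg ?_).congr ?_ ?_
  · calc _ = 32 * N ^ 5 * (t - s) ^ α := by ring
      _ ≤ 32 * N ^ 6 * (t - s) ^ α := by gcongr; norm_num
  all_goals
    ext v
    simp

variable [NormedSpace ℝ V2]

/-- The germ `Y_s Z_{s,t} + (Y'_s ⋆ Z'_s) 𝕏_{s,t}` of the compensated Riemann sums. -/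
noncomputable def germ (tops : TensorOps V V2 W U) (XX : ℝ → ℝ → V2)
    (Y : ℝ → W →L[ℝ] U) (Y' : ℝ → V →L[ℝ] (W →L[ℝ] U))
    (Z : ℝ → W) (Z' : ℝ → V →L[ℝ] W) (s t : ℝ) : U :=
  Y s (Z t - Z s) + tops.spair (Y' s) (Z' s) (XX s t)

theorem germ_sub_sub (tops : TensorOps V V2 W U) {X : ℝ → V} {XX : ℝ → ℝ → V2}
    (Y : ℝ → W →L[ℝ] U) (Y' : ℝ → V →L[ℝ] (W →L[ℝ] U))
    (Z : ℝ → W) (Z' : ℝ → V →L[ℝ] W) {s u t : ℝ}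
    (chen : XX s t = XX s u + XX u t + tops.tmul (X u - X s) (X t - X u)) :
    germ tops XX Y Y' Z Z' s t - germ tops XX Y Y' Z Z' s u - germ tops XX Y Y' Z Z' u t =
      -(Rem X Y Y' s u (Z t - Z u) +
        (Y' s (X u - X s) (Rem X Z Z' u t + (Z' u - Z' s) (X t - X u)) +
        (tops.spair (Y' u - Y' s) (Z' u) + tops.spair (Y' s) (Z' u - Z' s)) (XX u t))) := by
  rw [germ, chen, map_add, map_add, tops.spair_tmul]
  simp [germ, Rem]
  abel

variable {tops : TensorOps V V2 W U}

theorem pairBound_spair (tops : TensorOps V V2 W U) {c₁ c₂ : ℝ}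
    {A At : V →L[ℝ] (W →L[ℝ] U)} {B Bt : V →L[ℝ] W} (hA : PairBound δ c₁ A At)
    (hB : PairBound δ c₂ B Bt) :
    PairBound δ (2 * c₁ * c₂) (tops.spair A B) (tops.spair At Bt) :=
  hA.bilin tops.spair tops.spair_le hB

theorem pairBound_germ_sub_sub (hS : Scale T α N δ) (hX : RoughPair T α N δ X Xt XX XXt)
    (hR : IsRoughPath T α tops.tmul X XX) (hRt : IsRoughPath T α tops.tmul Xt XXt)
    (hY : ControlledPair T α N δ X Xt Y Yt Y' Yt')
    (hZ : ControlledPair T α N δ X Xt Z Zt Z' Zt')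
    {s u t : ℝ} (hs : 0 ≤ s) (hsu : s < u) (hut : u < t) (ht : t ≤ T) :
    PairBound δ (50 * N ^ 5 * (t - s) ^ (3 * α))
      (germ tops XX Y Y' Z Z' s t - germ tops XX Y Y' Z Z' s u - germ tops XX Y Y' Z Z' u t)
      (germ tops XXt Yt Yt' Zt Zt' s t - germ tops XXt Yt Yt' Zt Zt' s u -
        germ tops XXt Yt Yt' Zt Zt' u t) := by
  have hN := hS.one_le
  have hu := hs.trans hsu.le
  have huT := hut.le.trans ht
  have h₁ := (hY.rem s u hs hsu huT).apply (hZ.increment hS hX hu hut ht)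
  have h₂ := ((hY.deriv_at hS hs (hsu.le.trans huT)).apply (hX.path s u hs hsu huT)).apply
    ((hZ.rem u t hu hut ht).add ((hZ.deriv s u hs hsu huT).apply (hX.path u t hu hut ht)))
  have h₃ := ((pairBound_spair tops (hY.deriv s u hs hsu huT) (hZ.deriv_at hS hu huT)).add
    (pairBound_spair tops (hY.deriv_at hS hs (hsu.le.trans huT))
      (hZ.deriv s u hs hsu huT))).apply (hX.area u t hu hut ht)
  refine ((h₁.add (h₂.add h₃)).neg.mono hS.nonneg ?_).congr
    (germ_sub_sub tops Y Y' Z Z' (hR.chen s u t hs hsu.le hut.le ht))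
    (germ_sub_sub tops Yt Yt' Zt Zt' (hRt.chen s u t hs hsu.le hut.le ht))
  have e : (t - s) ^ (3 * α) = ((t - s) ^ α) ^ 3 :=
    mod_cast rpow_natCast_mul_eq_pow (by linarith) α 3
  rw [e]
  have ha0 : 0 ≤ (u - s) ^ α := Real.rpow_nonneg (by linarith) _
  have hb0 : 0 ≤ (t - u) ^ α := Real.rpow_nonneg (by linarith) _
  have ha : (u - s) ^ α ≤ (t - s) ^ α :=
    Real.rpow_le_rpow (by linarith) (by linarith) hS.nonneg_exp.le
  have hb : (t - u) ^ α ≤ (t - s) ^ α :=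
    Real.rpow_le_rpow (by linarith) (by linarith) hS.nonneg_exp.le
  generalize (u - s) ^ α = a at *
  generalize (t - u) ^ α = b at *
  generalize (t - s) ^ α = r at *
  have hr0 : 0 ≤ r := ha0.trans ha
  calc _ ≤ 2 * (N * r ^ 2) * (5 * N ^ 3 * r) +
        (2 * (2 * (2 * N ^ 2) * (N * r)) * (N * r ^ 2 + 2 * (N * r) * (N * r)) +
        2 * (2 * (N * r) * (2 * N ^ 2) + 2 * (2 * N ^ 2) * (N * r)) * (N * r ^ 2)) := by
        gcongr
    _ = (26 * N ^ 4 + 8 * N ^ 4 + 16 * N ^ 5) * r ^ 3 := by ring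
    _ ≤ (26 * N ^ 5 + 8 * N ^ 5 + 16 * N ^ 5) * r ^ 3 := by gcongr <;> norm_num
    _ = _ := by ring

theorem IsPartition.exists_mesh_le {s t η : ℝ} (hst : s ≤ t) (hη : 0 < η) :
    ∃ n p, IsPartition s t n p ∧ ∀ i < n, p (i + 1) - p i ≤ η := by
  rcases hst.eq_or_lt with rfl | hst
  · exact ⟨0, fun _ => s, ⟨rfl, rfl, by simp⟩, by simp⟩
  · obtain ⟨n, hn⟩ := exists_nat_gt ((t - s) / η)
    have hn0 : (0 : ℝ) < n := (div_pos (sub_pos.2 hst) hη).trans hn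
    have hd : 0 < (t - s) / n := div_pos (sub_pos.2 hst) hn0
    refine ⟨n, fun i => s + i * ((t - s) / n), ⟨by simp, by field_simp; ring, fun i _ => ?_⟩,
      fun i _ => ?_⟩
    · push_cast
      linarith
    · have : (t - s) / n ≤ η := by
        rw [div_lt_iff₀ hη] at hn
        rw [div_le_iff₀ hn0]
        linarith
      push_cast
      linarith

/-- Sewing estimate for the increments of a pair of rough integrals. -/
theorem pairBound_integral_sub_germ (hα : 1 < 3 * α) (hS : Scale T α N δ)
    (hX : RoughPair T α N δ X Xt XX XXt)
    (hR : IsRoughPath T α tops.tmul X XX) (hRt : IsRoughPath T α tops.tmul Xt XXt)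
    (hY : ControlledPair T α N δ X Xt Y Yt Y' Yt')
    (hZ : ControlledPair T α N δ X Xt Z Zt Z' Zt')
    {s t : ℝ} (hs : 0 ≤ s) (hst : s < t) (ht : t ≤ T) {Is It Ist Itt : U}
    (hIs : IsRoughIntegral tops XX Y Y' Z Z' 0 s Is)
    (hIt : IsRoughIntegral tops XX Y Y' Z Z' 0 t It)
    (hIst : IsRoughIntegral tops XXt Yt Yt' Zt Zt' 0 s Ist)
    (hItt : IsRoughIntegral tops XXt Yt Yt' Zt Zt' 0 t Itt) :
    PairBound δ (sewingConst (3 * α) * (50 * N ^ 5) * (t - s) ^ (3 * α))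
      (It - Is - germ tops XX Y Y' Z Z' s t) (Itt - Ist - germ tops XXt Yt Yt' Zt Zt' s t) := by
  have hN := hS.one_le
  refine PairBound.of_approx fun ε hε => ?_
  obtain ⟨d₁, hd₁, h₁⟩ := hIs (ε / 2) (half_pos hε)
  obtain ⟨d₂, hd₂, h₂⟩ := hIt (ε / 2) (half_pos hε)
  obtain ⟨d₃, hd₃, h₃⟩ := hIst (ε / 2) (half_pos hε)
  obtain ⟨d₄, hd₄, h₄⟩ := hItt (ε / 2) (half_pos hε)
  obtain ⟨η, hη, hη'⟩ := exists_between (lt_min (lt_min hd₁ hd₂) (lt_min hd₃ hd₄))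
  obtain ⟨⟨l₁, l₂⟩, l₃, l₄⟩ : (η < d₁ ∧ η < d₂) ∧ η < d₃ ∧ η < d₄ := by
    simpa only [lt_min_iff] using hη'
  obtain ⟨n, p, hp, hpm⟩ := IsPartition.exists_mesh_le hs hη
  obtain ⟨k, hk⟩ := pow_unbounded_of_one_lt ((t - s) / η) (one_lt_two (α := ℝ))
  obtain ⟨m, q, hq, hqm, hqb⟩ := exists_partition_pairBound hα hS.nonneg
    (by positivity : 0 ≤ 50 * N ^ 5)
    (fun s u t hs hsu hut ht => pairBound_germ_sub_sub hS hX hR hRt hY hZ hs hsu hut ht)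
    k s t hs hst ht
  have hkη : (t - s) / 2 ^ k ≤ η := by
    rw [div_lt_iff₀ hη] at hk
    rw [div_le_iff₀ (by positivity)]
    linarith
  obtain ⟨r, hr, hrm, hsum⟩ := hp.exists_append U hq hpm fun i hi => (hqm i hi).trans hkη
  have key : ∀ (A : ℝ → ℝ → U) {a b g : U},
      ‖∑ i ∈ Finset.range n, A (p i) (p (i + 1)) - a‖ ≤ ε / 2 →
      ‖∑ i ∈ Finset.range (n + m), A (r i) (r (i + 1)) - b‖ ≤ ε / 2 →
      ‖∑ i ∈ Finset.range m, A (q i) (q (i + 1)) - g - (b - a - g)‖ ≤ ε := by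
    intro A a b g ha hb
    rw [hsum A] at hb
    refine le_trans (le_of_eq ?_) ((norm_sub_le_of_le hb ha).trans (le_of_eq (add_halves ε)))
    congr 1
    abel
  exact ⟨_, _,
    key (germ tops XX Y Y' Z Z') (h₁ n p hp fun i hi => (hpm i hi).trans_lt l₁)
      (h₂ _ r hr fun i hi => (hrm i hi).trans_lt l₂),
    key (germ tops XXt Yt Yt' Zt Zt') (h₃ n p hp fun i hi => (hpm i hi).trans_lt l₃)
      (h₄ _ r hr fun i hi => (hrm i hi).trans_lt l₄), hqb⟩

/-- Remainder estimate for a pair of rough integrals viewed as controlled paths. -/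
theorem pairBound_integral_rem (hα : 1 < 3 * α) (hS : Scale T α N δ)
    (hX : RoughPair T α N δ X Xt XX XXt)
    (hR : IsRoughPath T α tops.tmul X XX) (hRt : IsRoughPath T α tops.tmul Xt XXt)
    (hY : ControlledPair T α N δ X Xt Y Yt Y' Yt') (hY0 : PairBound δ N (Y 0) (Yt 0))
    (hZ : ControlledPair T α N δ X Xt Z Zt Z' Zt') {J Jt : ℝ → U}
    (hJ : ∀ t, 0 ≤ t → t ≤ T → IsRoughIntegral tops XX Y Y' Z Z' 0 t (J t))
    (hJt : ∀ t, 0 ≤ t → t ≤ T → IsRoughIntegral tops XXt Yt Yt' Zt Zt' 0 t (Jt t))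
    (a b : U) {s t : ℝ} (hs : 0 ≤ s) (hst : s < t) (ht : t ≤ T) :
    PairBound δ ((50 * sewingConst (3 * α) + 28) * N ^ 6 * (t - s) ^ (2 * α))
      (Rem X (fun t => a + J t) (fun t => (Y t).comp (Z' t)) s t)
      (Rem Xt (fun t => b + Jt t) (fun t => (Yt t).comp (Zt' t)) s t) := by
  have hN := hS.one_le
  have hsT := hst.le.trans ht
  have hC := sewingConst_pos hα
  have h₁ := pairBound_integral_sub_germ hα hS hX hR hRt hY hZ hs hst ht (hJ s hs hsT)
    (hJ t (hs.trans hst.le) ht) (hJt s hs hsT) (hJt t (hs.trans hst.le) ht)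
  have h₂ := (hY.value_at hS hX hY0 hs hsT).apply (hZ.rem s t hs hst ht)
  have h₃ := (pairBound_spair tops (hY.deriv_at hS hs hsT) (hZ.deriv_at hS hs hsT)).apply
    (hX.area s t hs hst ht)
  refine ((h₁.add (h₂.add h₃)).mono hS.nonneg ?_).congr ?_ ?_
  · have e₂ : (t - s) ^ (2 * α) = ((t - s) ^ α) ^ 2 :=
      mod_cast rpow_natCast_mul_eq_pow (by linarith) α 2
    have e₃ : (t - s) ^ (3 * α) = ((t - s) ^ α) ^ 3 :=
      mod_cast rpow_natCast_mul_eq_pow (by linarith) α 3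
    rw [e₂, e₃]
    have hr := hS.sub_rpow_le hs hst.le ht
    have hr0 : 0 ≤ (t - s) ^ α := Real.rpow_nonneg (by linarith) _
    generalize (t - s) ^ α = r at *
    calc _ = (50 * sewingConst (3 * α) * N ^ 5 * r + 12 * N ^ 5 + 16 * N ^ 5) * r ^ 2 := by ring
      _ ≤ (50 * sewingConst (3 * α) * N ^ 5 * N + 12 * N ^ 6 + 16 * N ^ 6) * r ^ 2 := by
        gcongr <;> norm_num
      _ = _ := by ring
  all_goals
    simp [Rem, germ]
    abel

end Integral

end ControlledPair

section Seminorms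

variable {V V2 E F : Type*} [NormedAddCommGroup V] [NormedAddCommGroup V2]
  [NormedAddCommGroup E] [NormedAddCommGroup F] {T α β : ℝ}

theorem hnorm_nonneg (T β : ℝ) (A : ℝ → ℝ → E) : 0 ≤ hnorm T β A :=
  Real.sInf_nonneg fun _ h => h.1

theorem hnorm_le {A : ℝ → ℝ → E} {C : ℝ} (hC : 0 ≤ C)
    (h : ∀ s t : ℝ, 0 ≤ s → s < t → t ≤ T → ‖A s t‖ ≤ C * (t - s) ^ β) : hnorm T β A ≤ C :=
  csInf_le ⟨0, fun _ h => h.1⟩ ⟨hC, h⟩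

theorem HBound.norm_le_hnorm {A : ℝ → ℝ → E} (h : HBound T β A) {s t : ℝ} (hs : 0 ≤ s)
    (hst : s < t) (ht : t ≤ T) : ‖A s t‖ ≤ hnorm T β A * (t - s) ^ β := by
  have pos : ∀ {s t : ℝ}, s < t → 0 < (t - s) ^ β := fun h => Real.rpow_pos_of_pos (by linarith) _
  rw [← div_le_iff₀ (pos hst)]
  obtain ⟨C, hC⟩ := h
  refine le_csInf ⟨|C|, abs_nonneg C, fun s t hs hst ht => (hC s t hs hst ht).trans
    (mul_le_mul_of_nonneg_right (le_abs_self C) (pos hst).le)⟩ fun D hD => ?_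
  rw [div_le_iff₀ (pos hst)]
  exact hD.2 s t hs hst ht

theorem HBound.sub {A At : ℝ → ℝ → E} (h : HBound T β A) (ht : HBound T β At) :
    HBound T β fun s t => A s t - At s t := by
  obtain ⟨C, hC⟩ := h
  obtain ⟨D, hD⟩ := ht
  refine ⟨C + D, fun s t h0 h1 h2 => ?_⟩
  rw [add_mul]
  exact norm_sub_le_of_le (hC s t h0 h1 h2) (hD s t h0 h1 h2)

theorem PairBound.of_hnorm {A At : ℝ → ℝ → E} {M δ : ℝ} (h : HBound T β A)
    (ht : HBound T β At) (hM : hnorm T β A ≤ M) (hMt : hnorm T β At ≤ M)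
    (hd : hnorm T β (fun s t => A s t - At s t) ≤ M * δ) {s t : ℝ} (hs : 0 ≤ s) (hst : s < t)
    (htT : t ≤ T) : PairBound δ (M * (t - s) ^ β) (A s t) (At s t) := by
  have h0 : 0 ≤ (t - s) ^ β := Real.rpow_nonneg (by linarith) _
  refine ⟨(h.norm_le_hnorm hs hst htT).trans (mul_le_mul_of_nonneg_right hM h0),
    (ht.norm_le_hnorm hs hst htT).trans (mul_le_mul_of_nonneg_right hMt h0), ?_⟩
  rw [mul_right_comm]
  exact ((h.sub ht).norm_le_hnorm hs hst htT).trans (mul_le_mul_of_nonneg_right hd h0)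

variable [NormedSpace ℝ V] [NormedSpace ℝ V2] [NormedSpace ℝ E] [NormedSpace ℝ F]

theorem RoughPair.of_norm_le {M δ : ℝ} {tmul : V →L[ℝ] V →L[ℝ] V2} {X Xt : ℝ → V}
    {XX XXt : ℝ → ℝ → V2} (h : IsRoughPath T α tmul X XX) (ht : IsRoughPath T α tmul Xt XXt)
    (hM : rpNorm T α X XX ≤ M) (hMt : rpNorm T α Xt XXt ≤ M)
    (hd : rpDist T α X Xt XX XXt ≤ M * δ) : RoughPair T α M δ X Xt XX XXt where
  path s t hs hst htT := PairBound.of_hnorm h.x_hold ht.x_hold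
    ((le_add_of_nonneg_right (hnorm_nonneg _ _ _)).trans hM)
    ((le_add_of_nonneg_right (hnorm_nonneg _ _ _)).trans hMt)
    ((le_add_of_nonneg_right (hnorm_nonneg _ _ _)).trans hd) hs hst htT
  area s t hs hst htT := by
    have e : (t - s) ^ (2 * α) = ((t - s) ^ α) ^ 2 :=
      mod_cast rpow_natCast_mul_eq_pow (by linarith) α 2
    rw [← e]
    exact PairBound.of_hnorm h.xx_hold ht.xx_hold
      ((le_add_of_nonneg_left (hnorm_nonneg _ _ _)).trans hM)
      ((le_add_of_nonneg_left (hnorm_nonneg _ _ _)).trans hMt)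
      ((le_add_of_nonneg_left (hnorm_nonneg _ _ _)).trans hd) hs hst htT

theorem ControlledPair.of_norm_le {M δ : ℝ} {X Xt : ℝ → V} {Y Yt : ℝ → E}
    {Y' Yt' : ℝ → V →L[ℝ] E} (h : IsCRP T α X Y Y') (ht : IsCRP T α Xt Yt Yt')
    (h0 : ‖Y' 0‖ ≤ M) (h0t : ‖Yt' 0‖ ≤ M)
    (hM : crpNorm T α X Y Y' ≤ M) (hMt : crpNorm T α Xt Yt Yt' ≤ M)
    (hd : crpDist T α X Xt Y Y' Yt Yt' ≤ M * δ) (hd0 : ‖Y 0 - Yt 0‖ ≤ M * δ)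
    (hd0' : ‖Y' 0 - Yt' 0‖ ≤ M * δ) : ControlledPair T α M δ X Xt Y Yt Y' Yt' where
  zero := hd0
  deriv_zero := ⟨h0, h0t, hd0'⟩
  deriv s t hs hst htT := PairBound.of_hnorm h.deriv_hold ht.deriv_hold
    ((le_add_of_nonneg_left (hnorm_nonneg _ _ _)).trans hM)
    ((le_add_of_nonneg_left (hnorm_nonneg _ _ _)).trans hMt)
    ((le_add_of_nonneg_left (hnorm_nonneg _ _ _)).trans hd) hs hst htT
  rem s t hs hst htT := by
    have e : (t - s) ^ (2 * α) = ((t - s) ^ α) ^ 2 :=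
      mod_cast rpow_natCast_mul_eq_pow (by linarith) α 2
    rw [← e]
    exact PairBound.of_hnorm h.rem_hold ht.rem_hold
      ((le_add_of_nonneg_right (hnorm_nonneg _ _ _)).trans hM)
      ((le_add_of_nonneg_right (hnorm_nonneg _ _ _)).trans hMt)
      ((le_add_of_nonneg_right (hnorm_nonneg _ _ _)).trans hd) hs hst htT

theorem crpDist_nonneg (T α : ℝ) (X Xt : ℝ → V) (Y : ℝ → E) (Y' : ℝ → V →L[ℝ] E)
    (Yt : ℝ → E) (Yt' : ℝ → V →L[ℝ] E) : 0 ≤ crpDist T α X Xt Y Y' Yt Yt' :=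
  add_nonneg (hnorm_nonneg _ _ _) (hnorm_nonneg _ _ _)

theorem IsCb.norm_iteratedFDeriv_le {k j : ℕ} {f : E → F} (hf : IsCb k f) (hj : j ≤ k) (x : E) :
    ‖iteratedFDeriv ℝ j f x‖ ≤ cbNorm k f := by
  obtain ⟨C, hC⟩ := hf.2 j hj
  refine (le_ciSup (f := fun x => ‖iteratedFDeriv ℝ j f x‖)
    ⟨C, Set.forall_mem_range.2 hC⟩ x).trans ?_
  exact Finset.single_le_sum (f := fun j => ⨆ x : E, ‖iteratedFDeriv ℝ j f x‖)
    (fun i _ => Real.iSup_nonneg fun _ => norm_nonneg _) (Finset.mem_range.2 (by omega))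

theorem SmoothBound.of_contDiff {f : E → F} {M : ℝ} (hf : ContDiff ℝ 2 f)
    (h1 : ∀ x, ‖iteratedFDeriv ℝ 1 f x‖ ≤ M) (h2 : ∀ x, ‖iteratedFDeriv ℝ 2 f x‖ ≤ M) :
    SmoothBound M f (fderiv ℝ f) where
  hasFDerivAt x := (hf.differentiable two_ne_zero x).hasFDerivAt
  bound x := by
    rw [← norm_iteratedFDeriv_zero (𝕜 := ℝ) (f := fderiv ℝ f), norm_iteratedFDeriv_fderiv]
    exact h1 x
  lip := by
    have hf' : ContDiff ℝ 1 (fderiv ℝ f) := hf.fderiv_right (by norm_num)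
    refine norm_sub_le_of_hasFDerivAt
      (fun x => (hf'.differentiable one_ne_zero x).hasFDerivAt) fun x => ?_
    rw [← norm_iteratedFDeriv_zero (𝕜 := ℝ) (f := fderiv ℝ (fderiv ℝ f)),
      norm_iteratedFDeriv_fderiv, norm_iteratedFDeriv_fderiv]
    exact h2 x

end Seminorms

/-- stability of `𝐉` with respect to all data, for two different
driving rough paths. -/
theorem stmt17
    {V V2 W U : Type*} [NormedAddCommGroup V] [NormedSpace ℝ V] [CompleteSpace V]
    [NormedAddCommGroup V2] [NormedSpace ℝ V2] [CompleteSpace V2]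
    [NormedAddCommGroup W] [NormedSpace ℝ W] [CompleteSpace W]
    [NormedAddCommGroup U] [NormedSpace ℝ U] [CompleteSpace U]
    (T α : ℝ) (hT : 0 < T) (hα : 1 / 3 < α) (hα' : α ≤ 1 / 2)
    (tops : TensorOps V V2 U W) :
    ∀ K : ℝ, 0 < K → ∃ C : ℝ, 0 < C ∧
      ∀ (X Xt : ℝ → V) (XX XXt : ℝ → ℝ → V2),
        IsRoughPath T α tops.tmul X XX → IsRoughPath T α tops.tmul Xt XXt →
        rpNorm T α X XX ≤ K → rpNorm T α Xt XXt ≤ K →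
      ∀ F : W → U →L[ℝ] W, IsCb 3 F → cbNorm 3 F ≤ K →
      ∀ (Z Zt : ℝ → U) (Z' Zt' : ℝ → V →L[ℝ] U),
        IsCRP T α X Z Z' → IsCRP T α Xt Zt Zt' →
      ∀ (Y Yt : ℝ → W) (Y' Yt' : ℝ → V →L[ℝ] W),
        IsCRP T α X Y Y' → IsCRP T α Xt Yt Yt' →
        ‖Y' 0‖ ≤ K → ‖Yt' 0‖ ≤ K → ‖Z' 0‖ ≤ K → ‖Zt' 0‖ ≤ K →
        crpNorm T α X Y Y' ≤ K → crpNorm T α Xt Yt Yt' ≤ K →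
        crpNorm T α X Z Z' ≤ K → crpNorm T α Xt Zt Zt' ≤ K →
      ∀ J Jt : ℝ → W,
        (∀ t : ℝ, 0 ≤ t → t ≤ T →
          IsRoughIntegral tops XX (fun r => F (Y r))
            (fun r => (fderiv ℝ F (Y r)).comp (Y' r)) Z Z' 0 t (J t)) →
        (∀ t : ℝ, 0 ≤ t → t ≤ T →
          IsRoughIntegral tops XXt (fun r => F (Yt r))
            (fun r => (fderiv ℝ F (Yt r)).comp (Yt' r)) Zt Zt' 0 t (Jt t)) →
        crpDist T α X Xt (fun t => Y 0 + J t) (fun t => (F (Y t)).comp (Z' t))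
            (fun t => Yt 0 + Jt t) (fun t => (F (Yt t)).comp (Zt' t)) ≤
          C * (T ^ α * crpDist T α X Xt Y Y' Yt Yt' +
            ‖Y 0 - Yt 0‖ + ‖Y' 0 - Yt' 0‖ + crpDist T α X Xt Z Z' Zt Zt' +
            ‖Z 0 - Zt 0‖ + ‖Z' 0 - Zt' 0‖ + rpDist T α X Xt XX XXt) := by
  intro K hK
  have hTα : 0 < T ^ α := Real.rpow_pos_of_pos hT α
  have hα3 : 1 < 3 * α := by linarith
  have hC := sewingConst_pos hα3
  obtain ⟨M, hM⟩ : ∃ M, M = 1 + K + T ^ α := ⟨_, rfl⟩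
  obtain ⟨N, hN⟩ : ∃ N, N = 1214 * M ^ 11 := ⟨_, rfl⟩
  have hM1 : 1 ≤ M := by linarith
  have hKM : K ≤ M := by linarith
  have hMN : M ≤ N := by
    have := le_self_pow₀ hM1 (by norm_num : (11 : ℕ) ≠ 0)
    linarith
  have hN0 : 0 < N := by linarith
  refine ⟨(50 * sewingConst (3 * α) + 60) * N ^ 6 * (1 + (T ^ α)⁻¹), by positivity, ?_⟩
  intro X Xt XX XXt hX hXt hXK hXtK F hF hFK Z Zt Z' Zt' hZ hZt Y Yt Y' Yt' hY hYt
    hY0 hYt0 hZ0 hZt0 hYK hYtK hZK hZtK J Jt hJ hJt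
  set Δ : ℝ := T ^ α * crpDist T α X Xt Y Y' Yt Yt' +
    ‖Y 0 - Yt 0‖ + ‖Y' 0 - Yt' 0‖ + crpDist T α X Xt Z Z' Zt Zt' +
    ‖Z 0 - Zt 0‖ + ‖Z' 0 - Zt' 0‖ + rpDist T α X Xt XX XXt with hΔ
  have n₁ := mul_nonneg hTα.le (crpDist_nonneg T α X Xt Y Y' Yt Yt')
  have n₂ := norm_nonneg (Y 0 - Yt 0)
  have n₃ := norm_nonneg (Y' 0 - Yt' 0)
  have n₄ := crpDist_nonneg T α X Xt Z Z' Zt Zt'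
  have n₅ := norm_nonneg (Z 0 - Zt 0)
  have n₆ := norm_nonneg (Z' 0 - Zt' 0)
  have n₇ : 0 ≤ rpDist T α X Xt XX XXt := add_nonneg (hnorm_nonneg _ _ _) (hnorm_nonneg _ _ _)
  have hΔ0 : 0 ≤ Δ := by positivity
  obtain ⟨δ, hδ⟩ : ∃ δ, δ = (1 + (T ^ α)⁻¹) * Δ := ⟨_, rfl⟩
  have hδ0 : 0 ≤ δ := hδ ▸ by positivity
  clear_value Δ
  have hle : ∀ {x : ℝ}, x ≤ Δ → x ≤ M * δ := fun hx => by
    have h1 : Δ ≤ δ := hδ ▸ le_mul_of_one_le_left hΔ0 (by linarith [inv_pos.2 hTα])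
    linarith [le_mul_of_one_le_left hδ0 hM1]
  have hYd : crpDist T α X Xt Y Y' Yt Yt' ≤ M * δ := by
    have h1 : crpDist T α X Xt Y Y' Yt Yt' ≤ (T ^ α)⁻¹ * Δ := by
      rw [inv_mul_eq_div, le_div_iff₀ hTα]
      linarith
    linarith [le_mul_of_one_le_left hδ0 hM1]
  have hSM : Scale T α M δ := ⟨by linarith, hM1, hδ0, by linarith⟩
  have hSN := hSM.mono hMN
  have hXM : RoughPair T α M δ X Xt XX XXt :=
    .of_norm_le hX hXt (hXK.trans hKM) (hXtK.trans hKM) (hle (by linarith))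
  have hXN := hXM.mono hδ0 hMN
  have hYM : ControlledPair T α M δ X Xt Y Yt Y' Yt' :=
    .of_norm_le hY hYt (hY0.trans hKM) (hYt0.trans hKM) (hYK.trans hKM) (hYtK.trans hKM) hYd
      (hle (by linarith)) (hle (by linarith))
  have hZN : ControlledPair T α N δ X Xt Z Zt Z' Zt' :=
    (ControlledPair.of_norm_le hZ hZt (hZ0.trans hKM) (hZt0.trans hKM) (hZK.trans hKM)
      (hZtK.trans hKM) (hle (by linarith)) (hle (by linarith)) (hle (by linarith))).mono hδ0 hMN
  have hb : ∀ j ≤ 3, ∀ x, ‖iteratedFDeriv ℝ j F x‖ ≤ M := fun j hj x =>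
    (hF.norm_iteratedFDeriv_le hj x).trans (hFK.trans hKM)
  have hF3 : ContDiff ℝ 3 F := hF.1
  have hF1 : SmoothBound M F (fderiv ℝ F) :=
    .of_contDiff (hF3.of_le (by norm_num)) (hb 1 (by norm_num)) (hb 2 (by norm_num))
  have hF2 : SmoothBound M (fderiv ℝ F) (fderiv ℝ (fderiv ℝ F)) := by
    refine .of_contDiff (hF3.fderiv_right (by norm_num)) (fun x => ?_) fun x => ?_
    all_goals
      rw [norm_iteratedFDeriv_fderiv]
      exact hb _ (by norm_num) x
  have hQ := hYM.comp hSM hT.le hXM hF1 hF2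
  rw [← hN] at hQ
  have hF0 : ∀ x, ‖F x‖ ≤ N := fun x => by
    simpa using (hb 0 (by norm_num) x).trans hMN
  have hQ0 : PairBound δ N (F (Y 0)) (F (Yt 0)) := ⟨hF0 _, hF0 _, hQ.zero⟩
  have h₁ : hnorm T (2 * α) _ ≤ (50 * sewingConst (3 * α) + 28) * N ^ 6 * δ :=
    hnorm_le (by positivity) fun s t hs hst ht => ((pairBound_integral_rem hα3 hSN hXN hX hXt
      hQ hQ0 hZN hJ hJt (Y 0) (Yt 0) hs hst ht).diff.trans_eq (mul_right_comm _ _ _))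
  have h₂ : hnorm T α _ ≤ 32 * N ^ 6 * δ :=
    hnorm_le (by positivity) fun s t hs hst ht =>
      ((pairBound_comp_increment hSN hXN hQ hQ0 hZN hs hst ht).diff.trans_eq
        (mul_right_comm _ _ _))
  unfold crpDist
  refine (add_le_add h₁ h₂).trans (le_of_eq ?_)
  rw [hδ]
  ring
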